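/- arXiv:2105.06128 — 6 statements merged into one kernel-verified Lean document; each statement's English description precedes it below -/
import Mathlib

section
/- Let Γ be a profinite group acting continuously on a profinite set Y. For any two distinct points y, z ∈ Y there exists a Γ-stable finite partition 𝒬 of Y into clopen subsets such that y and z lie in different members of 𝒬. (This expresses the injectivity of the natural Γ-equivariant map from Y to the projective limit of its Γ-stable finite clopen partitions.) -/
open Pointwise

/-- Let `Γ` be a profinite group acting continuously on a profinite set `Y`.
For any two distinct points `y, z ∈ Y` there is a `Γ`-stable finite partition `Q` of `Y`
into clopen subsets separating `y` and `z` (no member of `Q` contains both). -/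
theorem stmt_3 (Γ Y : Type*) [Group Γ] [TopologicalSpace Γ] [IsTopologicalGroup Γ]
    [CompactSpace Γ] [T2Space Γ] [TotallyDisconnectedSpace Γ]
    [TopologicalSpace Y] [CompactSpace Y] [T2Space Y] [TotallyDisconnectedSpace Y]
    [MulAction Γ Y] [ContinuousSMul Γ Y]
    (y z : Y) (hyz : y ≠ z) :
    ∃ Q : Set (Set Y), Q.Finite ∧ (∀ B ∈ Q, IsClopen B ∧ B.Nonempty) ∧
      Q.PairwiseDisjoint id ∧ ⋃₀ Q = Set.univ ∧
      (∀ (g : Γ), ∀ B ∈ Q, g • B ∈ Q) ∧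
      ¬ ∃ B ∈ Q, y ∈ B ∧ z ∈ B := by
  obtain ⟨U, hU, hyU, hzU⟩ := exists_isClopen_of_totally_separated hyz
  have hW : ∀ a : Y, IsOpen {b : Y | ∀ g : Γ, (g • a ∈ U ↔ g • b ∈ U)} := by
    intro a
    have h1 : IsClopen {p : Γ × Y | p.1 • a ∈ U} :=
      hU.preimage (continuous_fst.smul continuous_const)
    have h2 : IsClopen {p : Γ × Y | p.1 • p.2 ∈ U} :=
      hU.preimage (continuous_fst.smul continuous_snd)
    have h3 : IsClosed (({p : Γ × Y | p.1 • a ∈ U} \ {p : Γ × Y | p.1 • p.2 ∈ U}) ∪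
        ({p : Γ × Y | p.1 • p.2 ∈ U} \ {p : Γ × Y | p.1 • a ∈ U})) :=
      ((h1.diff h2).union (h2.diff h1)).1
    have h4 := (isClosedMap_snd_of_compactSpace _ h3).isOpen_compl
    convert h4 using 1
    ext b
    simp only [Set.mem_ofPred_eq, Set.mem_compl_iff, Set.mem_image, Set.mem_union, Set.mem_sdiff,
      Prod.exists, exists_eq_right, not_exists]
    exact forall_congr' fun g => by tauto
  obtain ⟨S, hS⟩ : ∃ S : DiscreteQuotient Y, ∀ a b : Y,
      S.proj a = S.proj b ↔ ∀ g : Γ, (g • a ∈ U ↔ g • b ∈ U) :=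
    ⟨{ r := fun a b => ∀ g : Γ, (g • a ∈ U ↔ g • b ∈ U)
       iseqv := ⟨fun _ _ => Iff.rfl, fun h g => (h g).symm, fun h k g => (h g).trans (k g)⟩
       isOpen_setOfPred_rel := hW }, fun a b => Quotient.eq''⟩
  have hfin : Finite S := inferInstance
  refine ⟨Set.range fun q : S => S.proj ⁻¹' {q}, Set.finite_range _, ?_, ?_, ?_, ?_, ?_⟩
  · rintro _ ⟨q, rfl⟩
    exact ⟨S.isClopen_preimage _, S.proj_surjective q⟩
  · rintro _ ⟨q, rfl⟩ _ ⟨q', rfl⟩ hne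
    refine Set.disjoint_left.2 fun x hx hx' => hne ?_
    have e1 : S.proj x = q := hx
    have e2 : S.proj x = q' := hx'
    rw [← e1, ← e2]
  · exact Set.eq_univ_of_forall fun x => ⟨_, ⟨S.proj x, rfl⟩, rfl⟩
  · rintro g _ ⟨q, rfl⟩
    obtain ⟨a, rfl⟩ := S.proj_surjective q
    refine ⟨S.proj (g • a), ?_⟩
    ext b
    rw [Set.mem_smul_set_iff_inv_smul_mem]
    simp only [Set.mem_preimage, Set.mem_singleton_iff]
    rw [hS, hS]
    constructor
    · intro h k
      simpa [mul_smul] using h (k * g⁻¹)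
    · intro h k
      simpa [mul_smul] using h (k * g)
  · rintro ⟨_, ⟨q, rfl⟩, h1, h2⟩
    have e1 : S.proj y = q := h1
    have e2 : S.proj z = q := h2
    have h := (hS y z).1 (e1.trans e2.symm) 1
    rw [one_smul, one_smul] at h
    exact hzU (h.1 hyU)
end

section
/- Let G be a locally profinite group, let U be a compact open subgroup of G, let w ∈ G, and set U_w := U ∩ wUw⁻¹. Consider the twisted conjugation action of U_w on U given by u · x := (w⁻¹uw)xu⁻¹ for u ∈ U_w and x ∈ U. Then for x ∈ U, the U_w-orbit of x under this action is finite if and only if the centraliser C_G(wx) = {g ∈ G : g(wx) = (wx)g} is an open subgroup of G. -/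
/-- Let `G` be a locally profinite group, `U` a compact open subgroup,
`w ∈ G`, and `U_w := U ∩ wUw⁻¹` acting on `U` by twisted conjugation
`u · x := (w⁻¹uw)xu⁻¹`.  For `x ∈ U`, the `U_w`-orbit of `x` is finite if and only if the
centraliser `C_G(wx)` is open in `G`. -/
theorem stmt_8 (G : Type*) [Group G] [TopologicalSpace G] [IsTopologicalGroup G]
    [LocallyCompactSpace G] [T2Space G] [TotallyDisconnectedSpace G]
    (U : Subgroup G) (hUc : IsCompact (U : Set G)) (hUo : IsOpen (U : Set G))
    (w x : G) (hx : x ∈ U) :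
    {y : G | ∃ u : G, u ∈ U ∧ w⁻¹ * u * w ∈ U ∧ y = (w⁻¹ * u * w) * x * u⁻¹}.Finite ↔
      IsOpen ((Subgroup.centralizer {w * x} : Subgroup G) : Set G) := by
  set f : G → G := fun u => (w⁻¹ * u * w) * x * u⁻¹ with hf
  have hfc : Continuous f := by fun_prop
  have hgc : Continuous (fun u : G => w⁻¹ * u * w) := by fun_prop
  set K : Set G := (U : Set G) ∩ (fun u : G => w⁻¹ * u * w) ⁻¹' (U : Set G) with hK
  have hKo : IsOpen K := hUo.inter (hUo.preimage hgc)
  have hKc : IsCompact K := hUc.inter_right (hUc.isClosed.preimage hgc)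
  have hS : {y : G | ∃ u : G, u ∈ U ∧ w⁻¹ * u * w ∈ U ∧ y = (w⁻¹ * u * w) * x * u⁻¹}
      = f '' K := by
    ext y
    constructor
    · rintro ⟨u, h1, h2, h3⟩
      exact ⟨u, ⟨h1, h2⟩, h3.symm⟩
    · rintro ⟨u, ⟨h1, h2⟩, h3⟩
      exact ⟨u, h1, h2, h3.symm⟩
  have hcent : ∀ u : G, u ∈ Subgroup.centralizer {w * x} ↔ f u = x := by
    intro u
    rw [Subgroup.mem_centralizer_singleton_iff]
    have : f u = w⁻¹ * (u * (w * x) * u⁻¹) := by simp [hf, mul_assoc]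
    rw [this, inv_mul_eq_iff_eq_mul, mul_inv_eq_iff_eq_mul]
  have hconst : ∀ u c : G, f c = x → f (u * c) = f u := by
    intro u c hc
    have : f (u * c) = (w⁻¹ * u * w) * f c * u⁻¹ := by simp [hf, mul_assoc]
    rw [this, hc]
  rw [hS]
  constructor
  · intro hfin
    apply Subgroup.isOpen_of_mem_nhds (g := 1)
    have hcl : IsClosed (f '' K \ {x}) := (hfin.subset Set.diff_subset).isClosed
    have ho : IsOpen (K ∩ f ⁻¹' (f '' K \ {x})ᶜ) :=
      hKo.inter (hcl.isOpen_compl.preimage hfc)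
    refine Filter.mem_of_superset (ho.mem_nhds ?_) ?_
    · refine ⟨⟨U.one_mem, ?_⟩, ?_⟩
      · simp
      · simp [hf]
    · rintro u ⟨hu, hu2⟩
      refine (hcent u).2 ?_
      by_contra h
      exact hu2 ⟨⟨u, hu, rfl⟩, h⟩
  · intro ho
    obtain ⟨t, -, ht⟩ := hKc.elim_nhds_subcover
      (fun u => (fun v => u⁻¹ * v) ⁻¹' ((Subgroup.centralizer {w * x} : Subgroup G) : Set G))
      (fun u _ => (ho.preimage (by fun_prop)).mem_nhds (by simp [Subgroup.one_mem]))
    refine (t.finite_toSet.image f).subset ?_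
    rintro _ ⟨v, hv, rfl⟩
    obtain ⟨u, hu, huv⟩ := Set.mem_iUnion₂.1 (ht hv)
    refine ⟨u, hu, ?_⟩
    have := hconst u (u⁻¹ * v) ((hcent _).1 huv)
    rw [← this, mul_inv_cancel_left]
end

section
/- Let G be a topological group containing no proper open centralisers, i.e. such that every element of G whose centraliser is open in G lies in the center Z(G). Then for every open subgroup U of G, the center of U equals Z(G) ∩ U. -/
/-- Let `G` be a topological group containing no proper open centralisers
(every element with open centraliser is central).  Then for every open subgroup `U` of `G`,
the center of `U` equals `Z(G) ∩ U`. -/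
theorem stmt_9 (G : Type*) [Group G] [TopologicalSpace G] [IsTopologicalGroup G]
    (hG : ∀ y : G, IsOpen ((Subgroup.centralizer {y} : Subgroup G) : Set G) →
      y ∈ Subgroup.center G)
    (U : Subgroup G) (hUo : IsOpen (U : Set G)) :
    Subgroup.center U = (Subgroup.center G).subgroupOf U := by
  ext x
  rw [Subgroup.mem_subgroupOf]
  constructor
  · intro hx
    apply hG
    refine Subgroup.isOpen_mono (H₁ := U) ?_ hUo
    intro u hu
    rw [Subgroup.mem_centralizer_singleton_iff]
    have h := congrArg Subtype.val (Subgroup.mem_center_iff.mp hx ⟨u, hu⟩)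
    simp only [Subgroup.coe_mul] at h
    first | exact h | exact h.symm
  · intro hx
    rw [Subgroup.mem_center_iff] at hx ⊢
    intro u
    exact Subtype.ext (hx u)
end

section
/- Let G be a locally profinite group containing no proper open centralisers, let U be a compact open subgroup of G, let w ∈ G, and set U_w := U ∩ wUw⁻¹, with U_w acting on U by twisted conjugation u · x := (w⁻¹uw)xu⁻¹. Then the set Δ of elements x ∈ U whose U_w-orbit under this action is finite equals U ∩ w⁻¹Z(G). -/
open Pointwise

/-- Let `G` be a locally profinite group containing no proper open
centralisers, `U` a compact open subgroup, `w ∈ G`, with `U_w := U ∩ wUw⁻¹` acting on `U`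
by twisted conjugation `u · x := (w⁻¹uw)xu⁻¹`.  Then the set of `x ∈ U` with finite
`U_w`-orbit equals `U ∩ w⁻¹Z(G)`. -/
theorem stmt_10 (G : Type*) [Group G] [TopologicalSpace G] [IsTopologicalGroup G]
    [LocallyCompactSpace G] [T2Space G] [TotallyDisconnectedSpace G]
    (hG : ∀ y : G, IsOpen ((Subgroup.centralizer {y} : Subgroup G) : Set G) →
      y ∈ Subgroup.center G)
    (U : Subgroup G) (hUc : IsCompact (U : Set G)) (hUo : IsOpen (U : Set G)) (w : G) :
    {x : G | x ∈ U ∧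
        {y : G | ∃ u : G, u ∈ U ∧ w⁻¹ * u * w ∈ U ∧ y = (w⁻¹ * u * w) * x * u⁻¹}.Finite}
      = (U : Set G) ∩ w⁻¹ • ((Subgroup.center G : Subgroup G) : Set G) := by
  ext x
  rw [Set.mem_inter_iff, Set.mem_smul_set_iff_inv_smul_mem, inv_inv, smul_eq_mul]
  simp only [Set.mem_setOf_eq, SetLike.mem_coe]
  refine and_congr_right fun _ => ⟨fun hfin => hG _ ?_, fun hz => ?_⟩
  · apply Subgroup.isOpen_of_mem_nhds (g := 1)
    have hclosed := (hfin.subset (Set.diff_subset (t := {x}))).isClosed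
    have h1 : ∀ᶠ u in nhds (1 : G), u ∈ U := hUo.mem_nhds U.one_mem
    have hc : Continuous fun u : G => w⁻¹ * u * w := by fun_prop
    have h2 : ∀ᶠ u in nhds (1 : G), w⁻¹ * u * w ∈ U :=
      (hUo.preimage hc).mem_nhds (by simp [U.one_mem])
    have hc' : Continuous fun u : G => (w⁻¹ * u * w) * x * u⁻¹ := by fun_prop
    have h3 := (hclosed.isOpen_compl.preimage hc').mem_nhds (x := (1 : G)) (by simp)
    filter_upwards [h1, h2, h3] with u hu1 hu2 hu3
    have he : (w⁻¹ * u * w) * x * u⁻¹ = x := by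
      by_contra hne
      exact hu3 ⟨⟨u, hu1, hu2, rfl⟩, hne⟩
    rw [SetLike.mem_coe, Subgroup.mem_centralizer_singleton_iff]
    have h4 : w⁻¹ * u * w * x = x * u := mul_inv_eq_iff_eq_mul.mp he
    have h5 : u * (w * x) = w * x * u := by
      rw [mul_assoc w x u, ← h4]; group
    first | exact h5 | exact h5.symm
  · refine (Set.finite_singleton x).subset ?_
    rintro y ⟨u, -, -, rfl⟩
    have h := Subgroup.mem_center_iff.mp hz u
    rw [Set.mem_singleton_iff, mul_inv_eq_iff_eq_mul]
    calc w⁻¹ * u * w * x = w⁻¹ * (u * (w * x)) := by group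
      _ = x * u := by rw [h]; group
end

section
/- Let G be a locally profinite group containing no proper open centralisers, let U be a compact open subgroup of G, let w ∈ G, and set U_w := U ∩ wUw⁻¹, with U_w acting on U by twisted conjugation u · x := (w⁻¹uw)xu⁻¹. Let Δ be the set of x ∈ U with finite U_w-orbit. Then: if w ∈ Z(G), then Δ = U ∩ Z(G); and if w ∉ Z(G)U, then Δ = ∅. -/
open Pointwise

/-- Let `G` be a locally profinite group containing no proper open
centralisers, `U` a compact open subgroup, `w ∈ G`, with `U_w := U ∩ wUw⁻¹` acting on `U`
by twisted conjugation `u · x := (w⁻¹uw)xu⁻¹`, and let `Δ` be the set of `x ∈ U` with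
finite `U_w`-orbit.  If `w ∈ Z(G)` then `Δ = U ∩ Z(G)`; if `w ∉ Z(G)U` then `Δ = ∅`. -/
theorem stmt_11 (G : Type*) [Group G] [TopologicalSpace G] [IsTopologicalGroup G]
    [LocallyCompactSpace G] [T2Space G] [TotallyDisconnectedSpace G]
    (hG : ∀ y : G, IsOpen ((Subgroup.centralizer {y} : Subgroup G) : Set G) →
      y ∈ Subgroup.center G)
    (U : Subgroup G) (hUc : IsCompact (U : Set G)) (hUo : IsOpen (U : Set G)) (w : G) :
    (w ∈ Subgroup.center G →
      {x : G | x ∈ U ∧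
          {y : G | ∃ u : G, u ∈ U ∧ w⁻¹ * u * w ∈ U ∧ y = (w⁻¹ * u * w) * x * u⁻¹}.Finite}
        = (U : Set G) ∩ (Subgroup.center G : Set G)) ∧
    (w ∉ ((Subgroup.center G : Set G)) * (U : Set G) →
      {x : G | x ∈ U ∧
          {y : G | ∃ u : G, u ∈ U ∧ w⁻¹ * u * w ∈ U ∧ y = (w⁻¹ * u * w) * x * u⁻¹}.Finite}
        = ∅) := by
  have key : ∀ x : G,
      {y : G | ∃ u : G, u ∈ U ∧ w⁻¹ * u * w ∈ U ∧ y = (w⁻¹ * u * w) * x * u⁻¹}.Finite →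
      w * x ∈ Subgroup.center G := by
    intro x hF
    apply hG
    set F := {y : G | ∃ u : G, u ∈ U ∧ w⁻¹ * u * w ∈ U ∧ y = (w⁻¹ * u * w) * x * u⁻¹} with hFdef
    have hcl : IsOpen ((F \ {x})ᶜ) := (hF.subset Set.diff_subset).isClosed.isOpen_compl
    have hc : Continuous (fun u : G => (w⁻¹ * u * w) * x * u⁻¹) := by fun_prop
    have hc2 : Continuous (fun u : G => w⁻¹ * u * w) := by fun_prop
    have h1 := hUo.mem_nhds (show (1 : G) ∈ (U : Set G) from U.one_mem)
    have h2 := (hUo.preimage hc2).mem_nhds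
      (show (1 : G) ∈ (fun u : G => w⁻¹ * u * w) ⁻¹' (U : Set G) by simp [U.one_mem])
    have h3 := (hcl.preimage hc).mem_nhds
      (show (1 : G) ∈ (fun u : G => (w⁻¹ * u * w) * x * u⁻¹) ⁻¹' ((F \ {x})ᶜ) by simp)
    refine Subgroup.isOpen_of_mem_nhds _ (g := 1) ?_
    filter_upwards [h1, h2, h3] with u hu1 hu2 hu3
    have hx : (w⁻¹ * u * w) * x * u⁻¹ = x := by
      by_contra hne
      exact hu3 ⟨⟨u, hu1, hu2, rfl⟩, hne⟩
    show u ∈ Subgroup.centralizer {w * x}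
    rw [Subgroup.mem_centralizer_singleton_iff]
    have h4 : w⁻¹ * u * w * x = x * u := by
      rw [mul_inv_eq_iff_eq_mul] at hx
      exact hx
    have h5 : u * (w * x) = w * x * u := by
      calc u * (w * x) = w * (w⁻¹ * u * w * x) := by group
        _ = w * x * u := by rw [h4, mul_assoc]
    first
      | exact h5
      | exact h5.symm
  constructor
  · intro hw
    ext x
    constructor
    · rintro ⟨hx, hF⟩
      refine ⟨hx, ?_⟩
      have := (Subgroup.center G).mul_mem ((Subgroup.center G).inv_mem hw) (key x hF)
      simpa using this
    · rintro ⟨hx, hxc⟩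
      refine ⟨hx, (Set.finite_singleton x).subset ?_⟩
      rintro y ⟨u, -, -, rfl⟩
      have e1 := Subgroup.mem_center_iff.1 hw u
      have e2 := Subgroup.mem_center_iff.1 hxc u
      show w⁻¹ * u * w * x * u⁻¹ = x
      rw [mul_assoc w⁻¹ u w, e1, inv_mul_cancel_left, e2, mul_inv_cancel_right]
  · intro hw
    ext x
    simp only [Set.mem_empty_iff_false, iff_false]
    rintro ⟨hx, hF⟩
    exact hw ⟨w * x, key x hF, x⁻¹, U.inv_mem hx, by simp⟩
end

section
/- Let G be a locally profinite group and k a field, and let C = C_c^∞(G,k), the k-vector space of locally constant compactly supported functions G → k, equipped with the left translation action (g ·_ℓ f)(x) = f(g⁻¹x) and the right translation action (g ·_r f)(x) = f(xg). Inside the k-algebra End_k(C), let A_ℓ be the subalgebra of endomorphisms commuting with all left translations and A_r the subalgebra of endomorphisms commuting with all right translations. Then A_ℓ and A_r are mutual centralisers of each other in End_k(C): the centraliser of A_ℓ equals A_r, and the centraliser of A_r equals A_ℓ. -/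
/-- The space `C_c^∞(G,k)` of locally constant compactly supported `k`-valued functions,
as a `k`-submodule of `G → k`. -/
def SmoothCc (k G : Type*) [Field k] [TopologicalSpace G] : Submodule k (G → k) where
  carrier := {f | IsLocallyConstant f ∧ HasCompactSupport f}
  add_mem' := fun hf hg => ⟨hf.1.add hg.1, hf.2.add hg.2⟩
  zero_mem' := ⟨IsLocallyConstant.const 0, by
    rw [HasCompactSupport, tsupport]
    simp⟩
  smul_mem' := fun c f hf => ⟨hf.1.comp (c * ·), by
    have h := HasCompactSupport.smul_left (f := fun _ : G => c) hf.2
    exact h⟩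

variable {k G : Type*} [Field k] [Group G] [TopologicalSpace G]

/-- A `k`-linear endomorphism `T` of `C = C_c^∞(G,k)` commutes with the left translation
action `(g ·ℓ f)(x) = f(g⁻¹x)`:  whenever `h = g ·ℓ f` in `C`, we have `T h = g ·ℓ (T f)`. -/
def CommutesLeft (T : Module.End k (SmoothCc k G)) : Prop :=
  ∀ (g : G) (f h : SmoothCc k G), (∀ x : G, (h : G → k) x = (f : G → k) (g⁻¹ * x)) →
    ∀ x : G, (T h : G → k) x = (T f : G → k) (g⁻¹ * x)

/-- A `k`-linear endomorphism `T` of `C = C_c^∞(G,k)` commutes with the right translation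
action `(g ·r f)(x) = f(xg)`:  whenever `h = g ·r f` in `C`, we have `T h = g ·r (T f)`. -/
def CommutesRight (T : Module.End k (SmoothCc k G)) : Prop :=
  ∀ (g : G) (f h : SmoothCc k G), (∀ x : G, (h : G → k) x = (f : G → k) (x * g)) →
    ∀ x : G, (T h : G → k) x = (T f : G → k) (x * g)

open scoped Topology in
/-- Right stabiliser of a function. -/
def rStab {k G : Type*} [Group G] (f : G → k) : Subgroup G where
  carrier := {g | ∀ x, f (x * g) = f x}
  one_mem' := by simp
  mul_mem' := by
    intro a b ha hb x
    rw [← mul_assoc, hb, ha]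
  inv_mem' := by
    intro a ha x
    have := ha (x * a⁻¹)
    simpa using this.symm

open scoped Topology in
theorem rStab_open {k G : Type*} [Field k] [Group G] [TopologicalSpace G] [IsTopologicalGroup G]
    (f : G → k) (hf : f ∈ SmoothCc k G) : IsOpen (rStab f : Set G) := by
  obtain ⟨hl, hc⟩ := hf
  apply Subgroup.isOpen_of_mem_nhds (g := 1)
  have key : ∀ᶠ u in 𝓝 (1 : G), ∀ x ∈ tsupport f, f (x * u) = f x := by
    apply IsCompact.eventually_forall_of_forall_eventually hc
    intro x _
    have h1 : IsLocallyConstant (fun p : G × G => f (p.2 * p.1)) :=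
      hl.comp_continuous (f := fun p : G × G => p.2 * p.1) (by fun_prop)
    have h2 : IsLocallyConstant (fun p : G × G => f p.2) :=
      hl.comp_continuous (f := fun p : G × G => p.2) (by fun_prop)
    have e1 := h1.eventually_eq (1, x)
    have e2 := h2.eventually_eq (1, x)
    filter_upwards [e1, e2] with p hp1 hp2
    simp only [mul_one] at hp1 hp2
    rw [hp1, hp2]
  have key2 : ∀ᶠ u in 𝓝 (1 : G), ∀ x ∈ tsupport f, f (x * u⁻¹) = f x := by
    have : Filter.Tendsto (fun u : G => u⁻¹) (𝓝 1) (𝓝 1) := by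
      simpa using (continuous_inv (G := G)).tendsto 1
    exact this.eventually key
  filter_upwards [key, key2] with u h1 h2 x
  by_cases hx : x ∈ tsupport f
  · exact h1 x hx
  by_cases hy : x * u ∈ tsupport f
  · simpa using (h2 _ hy).symm
  · rw [image_eq_zero_of_notMem_tsupport hx, image_eq_zero_of_notMem_tsupport hy]

theorem indicator_mem {k G : Type*} [Field k] [TopologicalSpace G]
    (W : Set G) (hW : IsClopen W) (hc : IsCompact W) :
    W.indicator (fun _ => (1 : k)) ∈ SmoothCc k G := by
  refine ⟨?_, ?_⟩
  · rw [IsLocallyConstant.iff_eventually_eq]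
    intro x
    by_cases hx : x ∈ W
    · filter_upwards [hW.2.mem_nhds hx] with y hy
      simp [hx, hy]
    · filter_upwards [hW.compl.2.mem_nhds hx] with y hy
      have hy' : y ∉ W := hy
      simp [hx, hy']
  · refine hc.of_isClosed_subset (isClosed_tsupport _) ?_
    exact closure_minimal Set.support_indicator_subset hW.1

theorem exists_clopen {G : Type*} [Group G] [TopologicalSpace G]
    [LocallyCompactSpace G] [T2Space G] [TotallyDisconnectedSpace G] :
    ∃ W : Set G, IsClopen W ∧ IsCompact W ∧ (1 : G) ∈ W := by
  obtain ⟨s, hs, hs1⟩ := exists_compact_mem_nhds (1 : G)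
  obtain ⟨W, hW, h1, hWs⟩ := (loc_compact_Haus_tot_disc_of_zero_dim (H := G)).mem_nhds_iff.1 hs1
  exact ⟨W, hW, hs.of_isClosed_subset hW.1 hWs, h1⟩

theorem exists_K {k G : Type*} [Field k] [Group G] [TopologicalSpace G] [IsTopologicalGroup G]
    [LocallyCompactSpace G] [T2Space G] [TotallyDisconnectedSpace G]
    (f : G → k) (hf : f ∈ SmoothCc k G) :
    ∃ K : Subgroup G, IsOpen (K : Set G) ∧ IsCompact (K : Set G) ∧
      ∀ g ∈ K, ∀ x, f (x * g) = f x := by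
  obtain ⟨W, hW, hWc, h1⟩ := exists_clopen (G := G)
  have hi := indicator_mem (k := k) W hW hWc
  have ho : IsOpen ((rStab f ⊓ rStab (W.indicator (fun _ => (1 : k))) : Subgroup G) : Set G) := by
    rw [Subgroup.coe_inf]
    exact (rStab_open f hf).inter (rStab_open _ hi)
  refine ⟨_, ho, ?_, fun g hg => hg.1⟩
  refine hWc.of_isClosed_subset (Subgroup.isClosed_of_isOpen _ ho) ?_
  intro g hg
  have := hg.2 1
  by_contra hgW
  simp [h1, hgW] at this

theorem finite_out {G : Type*} [Group G] [TopologicalSpace G] [IsTopologicalGroup G]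
    (K : Subgroup G) (hK : IsOpen (K : Set G)) (M : Set G) (hM : IsCompact M) :
    {q : G ⧸ K | q.out ∈ M}.Finite := by
  have : DiscreteTopology (G ⧸ K) := QuotientGroup.discreteTopology hK
  have hfin := (hM.image (QuotientGroup.continuous_mk (N := K))).finite_of_discrete
  refine hfin.subset ?_
  intro q hq
  exact ⟨q.out, hq, QuotientGroup.out_eq' q⟩

/-- left translate of a function -/
theorem ltrans_mem {k G : Type*} [Field k] [Group G] [TopologicalSpace G] [IsTopologicalGroup G]
    (f : G → k) (hf : f ∈ SmoothCc k G) (g : G) :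
    (fun x => f (g⁻¹ * x)) ∈ SmoothCc k G :=
  ⟨hf.1.comp_continuous (f := fun x => g⁻¹ * x) (by fun_prop),
    hf.2.comp_homeomorph (Homeomorph.mulLeft g⁻¹)⟩

theorem rtrans_mem {k G : Type*} [Field k] [Group G] [TopologicalSpace G] [IsTopologicalGroup G]
    (f : G → k) (hf : f ∈ SmoothCc k G) (g : G) :
    (fun x => f (x * g)) ∈ SmoothCc k G :=
  ⟨hf.1.comp_continuous (f := fun x => x * g) (by fun_prop),
    hf.2.comp_homeomorph (Homeomorph.mulRight g)⟩

theorem formula {k G : Type*} [Field k] [Group G] [TopologicalSpace G] [IsTopologicalGroup G]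
    (T : Module.End k (SmoothCc k G)) (hT : CommutesLeft T)
    (K : Subgroup G) (hK : IsOpen (K : Set G)) (hKc : IsCompact (K : Set G)) :
    ∃ (Y : Finset (G ⧸ K)) (d : G ⧸ K → k), ∀ f : SmoothCc k G,
      (∀ g ∈ K, ∀ x, (f : G → k) (x * g) = (f : G → k) x) →
      ∀ x, (T f : G → k) x = ∑ y ∈ Y, d y * (f : G → k) (x * y.out) := by
  classical
  let e : SmoothCc k G := ⟨(K : Set G).indicator (fun _ => (1 : k)),
    indicator_mem _ ⟨Subgroup.isClosed_of_isOpen _ hK, hK⟩ hKc⟩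
  have he : ∀ x, (e : G → k) x = if x ∈ K then 1 else 0 := fun x => by
    simp [e, Set.indicator_apply]
  let t : G → k := (T e : G → k)
  have htK : ∀ g ∈ K, ∀ x, t (g * x) = t x := by
    intro g hg x
    have := hT g⁻¹ e e (fun x => by
      rw [he, he]; simp [Subgroup.mul_mem_cancel_left, hg]) x
    simpa using this.symm
  have htm : t ∈ SmoothCc k G := (T e).2
  have hd : {q : G ⧸ K | q.out ∈ (tsupport t)⁻¹}.Finite :=
    finite_out K hK _ (IsCompact.inv htm.2)
  refine ⟨hd.toFinset, fun q => t q.out⁻¹, fun f hf x => ?_⟩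
  have hF : {q : G ⧸ K | q.out ∈ tsupport (f : G → k)}.Finite := finite_out K hK _ f.2.2
  let E : G → SmoothCc k G := fun a => ⟨_, ltrans_mem (e : G → k) e.2 a⟩
  have hE : ∀ a x, (E a : G → k) x = (e : G → k) (a⁻¹ * x) := fun a x => rfl
  have hTE : ∀ a x, (T (E a) : G → k) x = t (a⁻¹ * x) := fun a x =>
    hT a e (E a) (hE a) x
  have hmk : ∀ a b : G, (a : G ⧸ K) = b → (f : G → k) a = (f : G → k) b := by
    intro a b hab
    rw [QuotientGroup.eq] at hab
    simpa using (hf _ hab a).symm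
  have hfe : f = ∑ q ∈ hF.toFinset, (f : G → k) q.out • E q.out := by
    ext z
    have hs : ((∑ q ∈ hF.toFinset, (f : G → k) q.out • E q.out : SmoothCc k G) : G → k) z
        = ∑ q ∈ hF.toFinset, (f : G → k) q.out * (if (z : G ⧸ K) = q then 1 else 0) := by
      simp only [Submodule.coe_sum, Finset.sum_apply, Submodule.coe_smul, Pi.smul_apply,
        smul_eq_mul, hE, he]
      refine Finset.sum_congr rfl fun q _ => ?_
      congr 2
      rw [← QuotientGroup.eq, QuotientGroup.out_eq']
      exact propext eq_comm
    rw [hs]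
    simp only [mul_ite, mul_one, mul_zero, Finset.sum_ite_eq]
    have hz : (f : G → k) z = (f : G → k) (z : G ⧸ K).out :=
      hmk _ _ (QuotientGroup.out_eq' _).symm
    split_ifs with h
    · exact hz
    · rw [hz]
      apply image_eq_zero_of_notMem_tsupport
      simpa using h
  have h1 : (T f : G → k) x = ∑ q ∈ hF.toFinset, (f : G → k) q.out * t (q.out⁻¹ * x) := by
    conv_lhs => rw [hfe]
    simp only [map_sum, map_smul, Submodule.coe_sum, Finset.sum_apply, Submodule.coe_smul,
      Pi.smul_apply, smul_eq_mul, hTE]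
  have h2 : (T f : G → k) x = ∑ᶠ q : G ⧸ K, (f : G → k) q.out * t (q.out⁻¹ * x) := by
    rw [h1, finsum_eq_sum_of_support_subset]
    intro q hq
    simp only [Set.Finite.coe_toFinset, Set.mem_ofPred_eq]
    by_contra h
    exact hq (by simp [image_eq_zero_of_notMem_tsupport h])
  have h3 : ∑ᶠ q : G ⧸ K, (f : G → k) q.out * t (q.out⁻¹ * x)
      = ∑ᶠ q : G ⧸ K, t q.out⁻¹ * (f : G → k) (x * q.out) := by
    rw [← finsum_comp_equiv (MulAction.toPerm x : Equiv.Perm (G ⧸ K))]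
    refine finsum_congr fun q => ?_
    have hq : (((MulAction.toPerm x : Equiv.Perm (G ⧸ K)) q).out : G ⧸ K) = ((x * q.out : G) : G ⧸ K) := by
      rw [QuotientGroup.out_eq', MulAction.toPerm_apply]
      conv_lhs => rw [← QuotientGroup.out_eq' q]
      rfl
    rw [hmk _ _ hq, mul_comm]
    congr 1
    rw [QuotientGroup.eq] at hq
    rw [← htK _ hq q.out⁻¹]
    congr 1
    group
  rw [h2, h3, finsum_eq_sum_of_support_subset]
  intro q hq
  simp only [Set.Finite.coe_toFinset, Set.mem_ofPred_eq]
  by_contra h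
  exact hq (by simp [image_eq_zero_of_notMem_tsupport (f := t) (x := q.out⁻¹) (by simpa using h)])

theorem commute_lr {k G : Type*} [Field k] [Group G] [TopologicalSpace G] [IsTopologicalGroup G]
    [LocallyCompactSpace G] [T2Space G] [TotallyDisconnectedSpace G]
    (T S : Module.End k (SmoothCc k G)) (hT : CommutesLeft T) (hS : CommutesRight S) :
    T * S = S * T := by
  ext f x
  obtain ⟨K, hK, hKc, hf⟩ := exists_K (f : G → k) f.2
  obtain ⟨Y, d, hY⟩ := formula T hT K hK hKc
  have hSf : ∀ g ∈ K, ∀ x, (S f : G → k) (x * g) = (S f : G → k) x := fun g hg x =>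
    (hS g f f (fun x => (hf g hg x).symm) x).symm
  let R : G → SmoothCc k G := fun a => ⟨_, rtrans_mem (f : G → k) f.2 a⟩
  have hSR : ∀ a x, (S (R a) : G → k) x = (S f : G → k) (x * a) := fun a x =>
    hS a f (R a) (fun _ => rfl) x
  have hTf : T f = ∑ y ∈ Y, d y • R y.out := by
    ext z
    rw [hY f hf]
    simp [R]
  change (T (S f) : G → k) x = (S (T f) : G → k) x
  rw [hY _ hSf, hTf]
  simp [hSR]

/-- Let `G` be a locally profinite group and `k` a field.  Inside
`End_k(C_c^∞(G,k))`, the subalgebra `A_ℓ` of endomorphisms commuting with all left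
translations and the subalgebra `A_r` of endomorphisms commuting with all right
translations are mutual centralisers of each other. -/
theorem stmt_14 (k G : Type*) [Field k] [Group G] [TopologicalSpace G] [IsTopologicalGroup G]
    [LocallyCompactSpace G] [T2Space G] [TotallyDisconnectedSpace G] :
    {T : Module.End k (SmoothCc k G) | CommutesLeft T}
        = Set.centralizer {T | CommutesRight T} ∧
    {T : Module.End k (SmoothCc k G) | CommutesRight T}
        = Set.centralizer {T | CommutesLeft T} := by
  refine ⟨Set.Subset.antisymm ?_ ?_, Set.Subset.antisymm ?_ ?_⟩
  · intro T hT S hS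
    exact (commute_lr T S hT hS).symm
  · intro T hT g f h hfh x
    let L : Module.End k (SmoothCc k G) :=
      { toFun := fun f => ⟨_, ltrans_mem (f : G → k) f.2 g⟩
        map_add' := fun _ _ => rfl
        map_smul' := fun _ _ => rfl }
    have hL : CommutesRight L := by
      intro a u v huv y
      change (v : G → k) (g⁻¹ * y) = (u : G → k) (g⁻¹ * (y * a))
      rw [huv, mul_assoc]
    have hh : h = L f := by
      ext y
      exact hfh y
    have := hT L hL
    have h2 : L (T f) = T (L f) := congrArg (fun A : Module.End k (SmoothCc k G) => A f) this
    rw [hh, ← h2]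
    rfl
  · intro T hT S hS
    exact commute_lr S T hS hT
  · intro T hT g f h hfh x
    let L : Module.End k (SmoothCc k G) :=
      { toFun := fun f => ⟨_, rtrans_mem (f : G → k) f.2 g⟩
        map_add' := fun _ _ => rfl
        map_smul' := fun _ _ => rfl }
    have hL : CommutesLeft L := by
      intro a u v huv y
      change (v : G → k) (y * g) = (u : G → k) ((a⁻¹ * y) * g)
      rw [huv, mul_assoc]
    have hh : h = L f := by
      ext y
      exact hfh y
    have := hT L hL
    have h2 : L (T f) = T (L f) := congrArg (fun A : Module.End k (SmoothCc k G) => A f) this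
    rw [hh, ← h2]
    rfl
end
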